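/- Let l, l1, l2 be lightlike vectors in the closed forward light cone V̄+ such that {l, l1} and {l, l2} are each linearly independent, and set W1 = W[l,l1], W2 = W[l,l2]. Then the spacelike complement of the closed set (closure of W1) ∩ (closure of W2) equals the causal complement of W1 ∩ W2, i.e. (cl(W1) ∩ cl(W2))^c = interior((W1 ∩ W2)^c). -/

import Mathlib

noncomputable section

/-- Minkowski spacetime: ℝ⁴. -/
abbrev M4 : Type := Fin 4 → ℝ

/-- Minkowski bilinear form. -/
def mink (x y : M4) : ℝ := x 0 * y 0 - x 1 * y 1 - x 2 * y 2 - x 3 * y 3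

/-- Lightlike vector. -/
def Lightlike (l : M4) : Prop := l ≠ 0 ∧ mink l l = 0

/-- Closed forward light cone. -/
def closedForwardCone : Set M4 := {x | 0 ≤ mink x x ∧ 0 ≤ x 0}

/-- Open forward light cone. -/
def openForwardCone : Set M4 := {x | 0 < mink x x ∧ 0 < x 0}

/-- The wedge W[l₁,l₂]. -/
def wedge (l1 l2 : M4) : Set M4 :=
  {x | ∃ (α β : ℝ) (p : M4), 0 < α ∧ β < 0 ∧ mink p l1 = 0 ∧ mink p l2 = 0 ∧
      x = α • l1 + β • l2 + p}

/-- Spacelike complement of a set. -/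
def scomp (S : Set M4) : Set M4 := {x | ∀ s ∈ S, mink (x - s) (x - s) < 0}

/-- Causal complement: the interior of the spacelike complement. -/
def ccomp (S : Set M4) : Set M4 := interior (scomp S)

open Set Filter Topology

lemma mink_comm (x y : M4) : mink x y = mink y x := by
  simp only [mink]; ring

lemma mink_add_left (x y z : M4) : mink (x + y) z = mink x z + mink y z := by
  simp only [mink, Pi.add_apply]; ring

lemma mink_sub_left (x y z : M4) : mink (x - y) z = mink x z - mink y z := by
  simp only [mink, Pi.sub_apply]; ring

lemma mink_smul_left (a : ℝ) (x z : M4) : mink (a • x) z = a * mink x z := by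
  simp only [mink, Pi.smul_apply, smul_eq_mul]; ring

lemma mink_add_right (x y z : M4) : mink z (x + y) = mink z x + mink z y := by
  simp only [mink, Pi.add_apply]; ring

lemma continuous_mink : Continuous fun p : M4 × M4 => mink p.1 p.2 := by
  unfold mink; fun_prop

@[fun_prop]
lemma Continuous.mink {X : Type*} [TopologicalSpace X] {f g : X → M4}
    (hf : Continuous f) (hg : Continuous g) : Continuous fun x => mink (f x) (g x) :=
  continuous_mink.comp (hf.prodMk hg)

/-- The reversed Cauchy–Schwarz inequality, in its weak form. -/
lemma mink_nonneg_of_mem_closedForwardCone {v w : M4} (hv : v ∈ closedForwardCone)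
    (hw : w ∈ closedForwardCone) : 0 ≤ mink v w := by
  obtain ⟨hv, hv0⟩ := hv
  obtain ⟨hw, hw0⟩ := hw
  simp only [mink] at *
  have cauchy : (v 1 * w 1 + v 2 * w 2 + v 3 * w 3) ^ 2 ≤
      (v 1 ^ 2 + v 2 ^ 2 + v 3 ^ 2) * (w 1 ^ 2 + w 2 ^ 2 + w 3 ^ 2) := by
    nlinarith [sq_nonneg (v 1 * w 2 - v 2 * w 1), sq_nonneg (v 1 * w 3 - v 3 * w 1),
      sq_nonneg (v 2 * w 3 - v 3 * w 2)]
  have bound : (v 1 ^ 2 + v 2 ^ 2 + v 3 ^ 2) * (w 1 ^ 2 + w 2 ^ 2 + w 3 ^ 2) ≤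
      v 0 ^ 2 * w 0 ^ 2 :=
    mul_le_mul (by linarith) (by linarith) (by positivity) (by positivity)
  have := abs_le_of_sq_le_sq' (a := v 1 * w 1 + v 2 * w 2 + v 3 * w 3) (b := v 0 * w 0)
    (by nlinarith) (by positivity)
  linarith [this.2]

lemma Lightlike.time_pos {l : M4} (h : Lightlike l) (hl : l ∈ closedForwardCone) :
    0 < l 0 := by
  refine lt_of_le_of_ne hl.2 fun h0 => h.1 ?_
  have h2 := h.2
  simp only [mink, ← h0] at h2
  ext i
  fin_cases i <;> simp <;>
    nlinarith [sq_nonneg (l 1), sq_nonneg (l 2), sq_nonneg (l 3)]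

lemma smul_eq_smul_of_mink_nonpos {a b : M4} (ha : mink a a = 0) (hb : mink b b = 0)
    (ha0 : 0 < a 0) (hb0 : 0 < b 0) (h : mink a b ≤ 0) : b 0 • a = a 0 • b := by
  have key : (b 0 * a 1 - a 0 * b 1) ^ 2 + (b 0 * a 2 - a 0 * b 2) ^ 2 +
      (b 0 * a 3 - a 0 * b 3) ^ 2 = 2 * (a 0 * b 0) * mink a b - b 0 ^ 2 * mink a a -
        a 0 ^ 2 * mink b b := by
    simp only [mink]; ring
  have hle : 2 * (a 0 * b 0) * mink a b ≤ 0 :=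
    mul_nonpos_of_nonneg_of_nonpos (by positivity) h
  rw [ha, hb] at key
  have s1 := sq_nonneg (b 0 * a 1 - a 0 * b 1)
  have s2 := sq_nonneg (b 0 * a 2 - a 0 * b 2)
  have s3 := sq_nonneg (b 0 * a 3 - a 0 * b 3)
  have e1 := pow_eq_zero_iff (two_ne_zero) |>.mp (le_antisymm (by linarith) s1)
  have e2 := pow_eq_zero_iff (two_ne_zero) |>.mp (le_antisymm (by linarith) s2)
  have e3 := pow_eq_zero_iff (two_ne_zero) |>.mp (le_antisymm (by linarith) s3)
  ext i
  fin_cases i <;> simp <;> linarith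

lemma mink_pos_of_linearIndependent {a b : M4} (ha : Lightlike a) (hb : Lightlike b)
    (hac : a ∈ closedForwardCone) (hbc : b ∈ closedForwardCone)
    (hli : LinearIndependent ℝ ![a, b]) : 0 < mink a b := by
  by_contra! h
  have heq := smul_eq_smul_of_mink_nonpos ha.2 hb.2 (ha.time_pos hac) (hb.time_pos hbc) h
  have := LinearIndependent.pair_iff.mp hli (b 0) (-a 0) (by rw [heq, neg_smul, add_neg_cancel])
  exact (hb.time_pos hbc).ne' this.1

lemma wedge_eq {a b : M4} (ha : mink a a = 0) (hb : mink b b = 0) (hab : 0 < mink a b) :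
    wedge a b = {x | mink x a < 0 ∧ 0 < mink x b} := by
  ext x
  constructor
  · rintro ⟨α, β, p, hα, hβ, hpa, hpb, rfl⟩
    simp only [mem_ofPred_eq, mink_add_left, mink_smul_left, ha, hb, hpa, hpb, mink_comm b a]
    exact ⟨by nlinarith, by nlinarith⟩
  · rintro ⟨hxa, hxb⟩
    refine ⟨mink x b / mink a b, mink x a / mink a b,
      x - ((mink x b / mink a b) • a + (mink x a / mink a b) • b),
      by positivity, div_neg_of_neg_of_pos hxa hab, ?_, ?_, by abel⟩
    all_goals
      simp only [mink_add_left, mink_sub_left, mink_smul_left, ha, hb, mink_comm b a]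
      field_simp
      ring

lemma mem_closure_of_forall_add_smul_mem {E : Type*} [AddCommGroup E] [Module ℝ E]
    [TopologicalSpace E] [ContinuousAdd E] [ContinuousSMul ℝ E] {s : Set E} {x u : E}
    (h : ∀ ε : ℝ, 0 < ε → x + ε • u ∈ s) : x ∈ closure s := by
  have lim : Tendsto (fun ε : ℝ => x + ε • u) (𝓝[>] 0) (𝓝 x) := by
    have hc : Continuous fun ε : ℝ => x + ε • u := by fun_prop
    simpa using (hc.tendsto 0).mono_left nhdsWithin_le_nhds
  exact mem_closure_of_tendsto lim (eventually_mem_nhdsWithin.mono h)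

lemma closure_wedge_eq {a b : M4} (ha : mink a a = 0) (hb : mink b b = 0)
    (hab : 0 < mink a b) : closure (wedge a b) = {x | mink x a ≤ 0 ∧ 0 ≤ mink x b} := by
  rw [wedge_eq ha hb hab]
  apply Subset.antisymm
  · refine closure_minimal (fun x hx => ⟨hx.1.le, hx.2.le⟩) ?_
    rw [ofPred_and]
    exact (isClosed_le (by fun_prop) (by fun_prop)).inter
      (isClosed_le (by fun_prop) (by fun_prop))
  · rintro x ⟨hxa, hxb⟩
    refine mem_closure_of_forall_add_smul_mem (u := a - b) fun ε hε => ?_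
    simp only [mem_ofPred_eq, mink_add_left, mink_sub_left, mink_smul_left, ha, hb, mink_comm b a]
    exact ⟨by nlinarith, by nlinarith⟩

lemma exists_pos_mul_time_le_mink {L : M4} (hL : L ∈ openForwardCone) :
    ∃ c > 0, ∀ v ∈ closedForwardCone, c * v 0 ≤ mink v L := by
  obtain ⟨hLL, hL0⟩ := hL
  have hc : mink L L / (2 * L 0) * L 0 = mink L L / 2 := by field_simp
  set c := mink L L / (2 * L 0) with hcdef
  have hcpos : 0 < c := by positivity
  refine ⟨c, hcpos, fun v hv => ?_⟩
  have hmem : ![L 0 - c, L 1, L 2, L 3] ∈ closedForwardCone := by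
    simp only [closedForwardCone, mem_ofPred_eq, mink, Matrix.cons_val] at *
    constructor
    · nlinarith
    · nlinarith [sq_nonneg (L 1), sq_nonneg (L 2), sq_nonneg (L 3)]
  have := mink_nonneg_of_mem_closedForwardCone hv hmem
  simp only [mink, Matrix.cons_val] at this ⊢
  linarith

lemma isClosed_closedForwardCone : IsClosed closedForwardCone := by
  rw [closedForwardCone, ofPred_and]
  exact (isClosed_le (by fun_prop) (by fun_prop)).inter (isClosed_le (by fun_prop) (by fun_prop))

lemma norm_le_time_of_mem_closedForwardCone {v : M4} (hv : v ∈ closedForwardCone) :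
    ‖v‖ ≤ v 0 := by
  obtain ⟨hv, hv0⟩ := hv
  simp only [mink] at hv
  refine (pi_norm_le_iff_of_nonneg hv0).mpr fun i => abs_le_of_sq_le_sq ?_ hv0
  fin_cases i <;> simp <;> nlinarith [sq_nonneg (v 1), sq_nonneg (v 2), sq_nonneg (v 3)]

/-- The causal future of a closed set on which a timelike functional is bounded below is closed. -/
lemma isClosed_forward_of_mink_nonneg {K : Set M4} (hK : IsClosed K) {L : M4}
    (hL : L ∈ openForwardCone) (hKL : ∀ s ∈ K, 0 ≤ mink s L) :
    IsClosed {x | ∃ v ∈ closedForwardCone, x - v ∈ K} := by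
  obtain ⟨c, hc, hcv⟩ := exists_pos_mul_time_le_mink hL
  refine IsSeqClosed.isClosed fun x y hx hxy => ?_
  choose v hv hvK using hx
  have hlim : Tendsto (fun n => mink (x n) L) atTop (𝓝 (mink y L)) :=
    ((by fun_prop : Continuous fun z : M4 => mink z L).tendsto y).comp hxy
  obtain ⟨B, hB⟩ := hlim.bddAbove_range
  have hbound : ∀ n, v n ∈ Metric.closedBall (0 : M4) (B / c) := fun n => by
    rw [mem_closedBall_zero_iff, le_div_iff₀ hc]
    have h1 := hKL _ (hvK n)
    rw [mink_sub_left] at h1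
    have h2 := hB ⟨n, rfl⟩
    simp only at h2
    nlinarith [norm_le_time_of_mem_closedForwardCone (hv n), hcv _ (hv n)]
  obtain ⟨w, -, φ, hφ, hw⟩ := tendsto_subseq_of_bounded Metric.isBounded_closedBall hbound
  exact ⟨w, isClosed_closedForwardCone.mem_of_tendsto hw (Eventually.of_forall fun n => hv _),
    hK.mem_of_tendsto ((hxy.comp hφ.tendsto_atTop).sub hw) (Eventually.of_forall fun n => hvK _)⟩

/-- For `l, l₁, l₂` lightlike and future directed, with `l` parallel to neither of `l₁, l₂`, the
spacelike complement of the intersection of the two closed wedges is open. -/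
lemma isOpen_scomp_cone {l l1 l2 : M4}
    (hl : Lightlike l) (h1 : Lightlike l1) (h2 : Lightlike l2)
    (hcl : l ∈ closedForwardCone) (hc1 : l1 ∈ closedForwardCone)
    (hc2 : l2 ∈ closedForwardCone) (hp1 : 0 < mink l l1) (hp2 : 0 < mink l l2) :
    IsOpen (scomp {x | mink x l ≤ 0 ∧ 0 ≤ mink x l1 ∧ 0 ≤ mink x l2}) := by
  set K := {x | mink x l ≤ 0 ∧ 0 ≤ mink x l1 ∧ 0 ≤ mink x l2} with hKdef
  have hK : IsClosed K := by
    rw [hKdef, ofPred_and, ofPred_and]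
    exact (isClosed_le (by fun_prop) (by fun_prop)).inter
      ((isClosed_le (by fun_prop) (by fun_prop)).inter (isClosed_le (by fun_prop) (by fun_prop)))
  have hscomp : scomp K = {x | 0 < mink x l} ∩ {x | ∃ v ∈ closedForwardCone, x - v ∈ K}ᶜ := by
    ext x
    constructor
    · intro hx
      refine ⟨?_, ?_⟩
      · by_contra! hxl
        simp only [mem_ofPred_eq, not_lt] at hxl
        set c := |mink x l1| / mink l l1 + |mink x l2| / mink l l2
        have hc1 : |mink x l1| ≤ c * mink l l1 := by
          rw [← div_le_iff₀ hp1]; exact le_add_of_nonneg_right (by positivity)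
        have hc2 : |mink x l2| ≤ c * mink l l2 := by
          rw [← div_le_iff₀ hp2]; exact le_add_of_nonneg_left (by positivity)
        have hmem : x + c • l ∈ K := by
          simp only [hKdef, mem_ofPred_eq, mink_add_left, mink_smul_left, hl.2]
          exact ⟨by linarith, by linarith [neg_abs_le (mink x l1)],
            by linarith [neg_abs_le (mink x l2)]⟩
        have := hx _ hmem
        rw [show x - (x + c • l) = (-c) • l by rw [neg_smul]; abel, mink_smul_left, mink_comm,
          mink_smul_left, hl.2] at this
        simp at this
      · rintro ⟨v, hv, hvK⟩
        have := hx _ hvK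
        rw [sub_sub_cancel] at this
        exact this.not_ge hv.1
    · rintro ⟨hxl, hx⟩ s hs
      by_contra! hxs
      rcases le_total 0 ((x - s) 0) with h0 | h0
      · exact hx ⟨x - s, ⟨hxs, h0⟩, by rwa [sub_sub_cancel]⟩
      · have hpast : s - x ∈ closedForwardCone := by
          refine ⟨?_, by simp only [Pi.sub_apply] at h0 ⊢; linarith⟩
          rw [show mink (s - x) (s - x) = mink (x - s) (x - s) by
            simp only [mink, Pi.sub_apply]; ring]
          exact hxs
        have := mink_nonneg_of_mem_closedForwardCone hpast hcl
        rw [mink_sub_left] at this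
        have hsl := hs.1
        simp only [mem_ofPred_eq] at hxl
        linarith
  rw [hscomp]
  refine (isOpen_lt (by fun_prop) (by fun_prop)).inter (IsClosed.isOpen_compl (self := ?_))
  have t1 := h1.time_pos hc1
  have t2 := h2.time_pos hc2
  rcases lt_or_ge 0 (mink l1 l2) with h12 | h12
  · refine isClosed_forward_of_mink_nonneg hK (L := l1 + l2) ⟨?_, ?_⟩ fun s hs => ?_
    · simp only [mink_add_left, mink_add_right, h1.2, h2.2, mink_comm l2 l1]; linarith
    · simp only [Pi.add_apply]; linarith
    · rw [mink_add_right]; linarith [hs.2.1, hs.2.2]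
  · have hpar := smul_eq_smul_of_mink_nonpos h1.2 h2.2 t1 t2 h12
    have hmink (y : M4) : l2 0 * mink y l1 = l1 0 * mink y l2 := by
      rw [mink_comm y l1, mink_comm y l2, ← mink_smul_left, ← mink_smul_left, hpar]
    suffices heq : {x | ∃ v ∈ closedForwardCone, x - v ∈ K} = {x | 0 ≤ mink x l1} by
      rw [heq]; exact isClosed_le (by fun_prop) (by fun_prop)
    ext x
    constructor
    · rintro ⟨v, hv, -, hvK, -⟩
      rw [mink_sub_left] at hvK
      have := mink_nonneg_of_mem_closedForwardCone hv hc1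
      simp only [mem_ofPred_eq]; linarith
    · intro hx
      simp only [mem_ofPred_eq] at hx
      set c := |mink x l| / mink l l1
      have hc0 : 0 ≤ c := by positivity
      have hc : c * mink l l1 = |mink x l| := by simp only [c]; field_simp
      have hx1 : 0 ≤ mink (x - c • l1) l1 := by
        rw [mink_sub_left, mink_smul_left, h1.2]; linarith
      refine ⟨c • l1, ⟨?_, ?_⟩, ?_, hx1, ?_⟩
      · rw [mink_smul_left, mink_comm, mink_smul_left, h1.2]; simp
      · simp only [Pi.smul_apply, smul_eq_mul]; positivity
      · rw [mink_sub_left, mink_smul_left, mink_comm l1 l, hc]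
        linarith [le_abs_self (mink x l)]
      · refine nonneg_of_mul_nonneg_right (a := l1 0) ?_ t1
        rw [← hmink]; positivity

/-- Points in the interior of a spacelike complement are spacelike to the closure. -/
lemma interior_scomp_subset_scomp_closure (S : Set M4) :
    interior (scomp S) ⊆ scomp (closure S) := by
  intro x hx s hs
  by_contra! hxs
  obtain ⟨x', hx', hpos⟩ : ∃ x' ∈ scomp S, 0 < mink (x' - s) (x' - s) := by
    set σ : ℝ := if 0 ≤ (x - s) 0 then 1 else -1 with hσ
    set e : M4 := ![σ, 0, 0, 0] with he
    have hlim : Tendsto (fun ε : ℝ => x + ε • e) (𝓝[>] 0) (𝓝 x) := by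
      have hc : Continuous fun ε : ℝ => x + ε • e := by fun_prop
      simpa using (hc.tendsto 0).mono_left nhdsWithin_le_nhds
    obtain ⟨ε, hmem, hε⟩ := ((hlim.eventually (mem_interior_iff_mem_nhds.mp hx)).and
      eventually_mem_nhdsWithin).exists
    simp only [mem_Ioi] at hε
    refine ⟨_, hmem, ?_⟩
    have hexp : mink (x + ε • e - s) (x + ε • e - s) =
        mink (x - s) (x - s) + 2 * ε * (σ * (x - s) 0) + ε ^ 2 * σ ^ 2 := by
      simp only [mink, he, Pi.add_apply, Pi.sub_apply, Pi.smul_apply, smul_eq_mul,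
        Matrix.cons_val]
      ring
    have hσ1 : σ ^ 2 = 1 := by rw [hσ]; split_ifs <;> norm_num
    have hσ2 : 0 ≤ σ * (x - s) 0 := by rw [hσ]; split_ifs <;> linarith
    rw [hexp, hσ1]
    positivity
  have hopen : IsOpen {s | 0 < mink (x' - s) (x' - s)} := isOpen_lt (by fun_prop) (by fun_prop)
  obtain ⟨t, ht, htS⟩ := mem_closure_iff.mp hs _ hopen hpos
  exact (hx' t htS).not_gt ht

theorem scomp_closure_inter_eq_ccomp_inter (l l1 l2 : M4)
    (hl : Lightlike l) (h1 : Lightlike l1) (h2 : Lightlike l2)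
    (hcl : l ∈ closedForwardCone) (hc1 : l1 ∈ closedForwardCone)
    (hc2 : l2 ∈ closedForwardCone)
    (hli1 : LinearIndependent ℝ ![l, l1]) (hli2 : LinearIndependent ℝ ![l, l2]) :
    scomp (closure (wedge l l1) ∩ closure (wedge l l2)) =
      interior (scomp (wedge l l1 ∩ wedge l l2)) := by
  have hp1 := mink_pos_of_linearIndependent hl h1 hcl hc1 hli1
  have hp2 := mink_pos_of_linearIndependent hl h2 hcl hc2 hli2
  have h12 := mink_nonneg_of_mem_closedForwardCone hc1 hc2
  have hK : closure (wedge l l1) ∩ closure (wedge l l2) =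
      {x | mink x l ≤ 0 ∧ 0 ≤ mink x l1 ∧ 0 ≤ mink x l2} := by
    rw [closure_wedge_eq hl.2 h1.2 hp1, closure_wedge_eq hl.2 h2.2 hp2]
    ext x
    simp only [mem_inter_iff, mem_ofPred_eq]
    tauto
  apply Subset.antisymm
  · refine interior_maximal (fun x hx s hs => hx s ⟨subset_closure hs.1, subset_closure hs.2⟩) ?_
    rw [hK]
    exact isOpen_scomp_cone hl h1 h2 hcl hc1 hc2 hp1 hp2
  · refine (interior_scomp_subset_scomp_closure _).trans fun x hx s hs => hx s ?_
    rw [hK] at hs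
    obtain ⟨hs, hs1, hs2⟩ := hs
    set α := mink l1 l2 / mink l l1 + mink l1 l2 / mink l l2 + 1
    have hα1 : mink l1 l2 < α * mink l l1 := by
      rw [← div_lt_iff₀ hp1]
      have : 0 ≤ mink l1 l2 / mink l l2 := by positivity
      simp only [α]; linarith
    have hα2 : mink l1 l2 < α * mink l l2 := by
      rw [← div_lt_iff₀ hp2]
      have : 0 ≤ mink l1 l2 / mink l l1 := by positivity
      simp only [α]; linarith
    refine mem_closure_of_forall_add_smul_mem (u := α • l - (l1 + l2)) fun ε hε => ?_
    rw [wedge_eq hl.2 h1.2 hp1, wedge_eq hl.2 h2.2 hp2]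
    simp only [mem_inter_iff, mem_ofPred_eq, mink_add_left, mink_sub_left, mink_smul_left,
      hl.2, h1.2, h2.2, mink_comm l1 l, mink_comm l2 l, mink_comm l2 l1]
    refine ⟨⟨?_, ?_⟩, ?_, ?_⟩ <;> nlinarith
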